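/- arXiv:2303.11943 — 4 statements merged into one kernel-verified Lean document; each statement's English description precedes it below -/
import Mathlib

section
/- With x̂ᵢ = yᵢ/‖yᵢ‖₂, the residual of the approximate eigenpair (r(yᵢ), x̂ᵢ) for the perturbed Laplacian satisfies ‖(L + E − r(yᵢ)·I) x̂ᵢ‖₂ ≤ τ + ‖E‖₂. -/
open Matrix

theorem aux_norm_sq {n : ℕ} (x : Fin n → ℝ) :
    Real.sqrt (x ⬝ᵥ x) = ‖WithLp.toLp 2 x‖ := by
  rw [EuclideanSpace.norm_eq]
  congr 1
  simp [dotProduct, sq]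

theorem aux_dot_sq {n : ℕ} (x : Fin n → ℝ) :
    x ⬝ᵥ x = ‖WithLp.toLp 2 x‖ ^ 2 := by
  rw [← aux_norm_sq, Real.sq_sqrt]
  exact Finset.sum_nonneg fun i _ => mul_self_nonneg _

theorem aux_op {n : ℕ} (A : Matrix (Fin n) (Fin n) ℝ) (x : Fin n → ℝ) :
    ‖WithLp.toLp 2 (A *ᵥ x)‖ ≤ ‖Matrix.toEuclideanCLM (𝕜 := ℝ) A‖ * ‖WithLp.toLp 2 x‖ := by
  have := (Matrix.toEuclideanCLM (𝕜 := ℝ) A).le_opNorm (WithLp.toLp 2 x)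
  simpa using this

theorem aux_quad {n : ℕ} (A : Matrix (Fin n) (Fin n) ℝ) (x : Fin n → ℝ) :
    |x ⬝ᵥ (A *ᵥ x)| ≤ ‖Matrix.toEuclideanCLM (𝕜 := ℝ) A‖ * (x ⬝ᵥ x) := by
  have h := abs_real_inner_le_norm (WithLp.toLp 2 (A *ᵥ x)) (WithLp.toLp 2 x)
  rw [EuclideanSpace.inner_toLp_toLp] at h
  simp only [star_trivial] at h
  rw [aux_dot_sq]
  have := mul_le_mul_of_nonneg_right (aux_op A x) (norm_nonneg (WithLp.toLp 2 x))
  nlinarith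

theorem aux_pos {n : ℕ} {x : Fin n → ℝ} (hx : x ≠ 0) : 0 < x ⬝ᵥ x := by
  refine lt_of_le_of_ne (Finset.sum_nonneg fun i _ => mul_self_nonneg _) fun h => hx ?_
  exact dotProduct_self_eq_zero.1 h.symm

theorem aux_ray {n : ℕ} (A : Matrix (Fin n) (Fin n) ℝ) {x : Fin n → ℝ} (hx : x ≠ 0) :
    |(x ⬝ᵥ (A *ᵥ x)) / (x ⬝ᵥ x)| ≤ ‖Matrix.toEuclideanCLM (𝕜 := ℝ) A‖ := by
  rw [abs_div, abs_of_pos (aux_pos hx), div_le_iff₀ (aux_pos hx)]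
  exact aux_quad A x

theorem aux_sym {n : ℕ} (S : Matrix (Fin n) (Fin n) ℝ) (hS : Sᵀ = S) (t : ℝ) (ht : 0 ≤ t)
    (h1 : ∀ x, x ⬝ᵥ (S *ᵥ x) ≤ t * (x ⬝ᵥ x)) (h2 : ∀ x, -(t * (x ⬝ᵥ x)) ≤ x ⬝ᵥ (S *ᵥ x))
    (x : Fin n → ℝ) : (S *ᵥ x) ⬝ᵥ (S *ᵥ x) ≤ t ^ 2 * (x ⬝ᵥ x) := by
  have key : ∀ z : Fin n → ℝ, 2 * (z ⬝ᵥ (S *ᵥ x)) ≤ t * (x ⬝ᵥ x + z ⬝ᵥ z) := by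
    intro z
    have e1 := h1 (x + z)
    have e2 := h2 (x - z)
    have e3 : x ⬝ᵥ (S *ᵥ z) = z ⬝ᵥ (S *ᵥ x) := by
      rw [dotProduct_mulVec, ← mulVec_transpose, hS, dotProduct_comm]
    have e4 : x ⬝ᵥ z = z ⬝ᵥ x := dotProduct_comm _ _
    simp only [mulVec_add, mulVec_sub, dotProduct_add, add_dotProduct, dotProduct_sub,
      sub_dotProduct, e3, e4] at e1 e2
    nlinarith
  have hx : 0 ≤ x ⬝ᵥ x := Finset.sum_nonneg fun i _ => mul_self_nonneg _
  rcases ht.eq_or_lt with h0 | hpos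
  · have := key (S *ᵥ x)
    rw [← h0] at this ⊢
    linarith
  · have := key (t⁻¹ • (S *ᵥ x))
    simp only [smul_dotProduct, dotProduct_smul, smul_eq_mul] at this
    set q := (S *ᵥ x) ⬝ᵥ (S *ᵥ x)
    have h3 := mul_le_mul_of_nonneg_left this hpos.le
    have e1 : t * (2 * (t⁻¹ * q)) = 2 * q := by field_simp
    have e2 : t * (t * (x ⬝ᵥ x + t⁻¹ * (t⁻¹ * q))) = t ^ 2 * (x ⬝ᵥ x) + q := by field_simp
    rw [e1, e2] at h3
    linarith

/-- **Theorem 1 of the paper.** Let `L = Bᵀ W B` be the Laplacian of an undirected weighted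
graph (`B 𝟙 = 0`, `W` diagonal nonnegative) and `E = Bᵀ W^{1/2} D W^{1/2} B` a perturbation.
Let `φ` be a unit eigenvector of `L` for the eigenvalue `λᵢ` with `𝟙ᵀ φ = 0`, set `a = E φ`,
`ε = φᵀ E φ ≠ 0`, assume `aᵀ(L + E − λᵢI − εI)a ≠ 0`, and define
`yᵢ = (1/ε)((aᵀa / aᵀ(L + E − λᵢI − εI)a) · Eφ − φ) ≠ 0` and `x̂ᵢ = yᵢ/‖yᵢ‖₂`. With
`r(y) = yᵀ(L+E)y / yᵀy`, `λ₂(L+E) = inf` of the Rayleigh quotient of `L+E` over nonzero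
vectors orthogonal to `𝟙`, `λₙ(L+E) = sup` of the Rayleigh quotient of `L+E`, `λₙ` the largest
eigenvalue of `L` (i.e. `sup` of its Rayleigh quotient), and
`τ = max(|λₙ − λ₂(L+E)|, λₙ(L+E))`, the residual satisfies
`‖(L + E − r(yᵢ) I) x̂ᵢ‖₂ ≤ τ + ‖E‖₂`. -/
theorem residual_bound_approx_eigenpair {n m : ℕ} (hn : 0 < n)
    (B : Matrix (Fin m) (Fin n) ℝ) (hB : B *ᵥ (fun _ => (1 : ℝ)) = 0)
    (w : Fin m → ℝ) (hw : ∀ e, 0 ≤ w e)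
    (L : Matrix (Fin n) (Fin n) ℝ) (hL : L = Bᵀ * diagonal w * B)
    (d : Fin m → ℝ)
    (E : Matrix (Fin n) (Fin n) ℝ)
    (hE : E = Bᵀ * diagonal (fun e => Real.sqrt (w e)) * diagonal d *
      diagonal (fun e => Real.sqrt (w e)) * B)
    (φ : Fin n → ℝ) (lam_i : ℝ)
    (hφ : L *ᵥ φ = lam_i • φ)
    (hφnorm : φ ⬝ᵥ φ = 1)
    (hφone : (fun _ => (1 : ℝ)) ⬝ᵥ φ = 0)
    (a : Fin n → ℝ) (ha : a = E *ᵥ φ)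
    (ε : ℝ) (hεdef : ε = φ ⬝ᵥ (E *ᵥ φ)) (hε0 : ε ≠ 0)
    (den : ℝ)
    (hden : den = a ⬝ᵥ ((L + E - lam_i • (1 : Matrix (Fin n) (Fin n) ℝ) - ε • 1) *ᵥ a))
    (hden0 : den ≠ 0)
    (y : Fin n → ℝ)
    (hy : y = ε⁻¹ • (((a ⬝ᵥ a) / den) • (E *ᵥ φ) - φ))
    (hy0 : y ≠ 0)
    (xhat : Fin n → ℝ) (hxhat : xhat = (Real.sqrt (y ⬝ᵥ y))⁻¹ • y)
    (r : ℝ) (hr : r = (y ⬝ᵥ ((L + E) *ᵥ y)) / (y ⬝ᵥ y))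
    (lamN : ℝ)
    (hlamN : lamN = sSup {c : ℝ | ∃ x : Fin n → ℝ, x ≠ 0 ∧
      c = (x ⬝ᵥ (L *ᵥ x)) / (x ⬝ᵥ x)})
    (lam2' : ℝ)
    (hlam2' : lam2' = sInf {c : ℝ | ∃ x : Fin n → ℝ, x ≠ 0 ∧
      (fun _ => (1 : ℝ)) ⬝ᵥ x = 0 ∧ c = (x ⬝ᵥ ((L + E) *ᵥ x)) / (x ⬝ᵥ x)})
    (lamN' : ℝ)
    (hlamN' : lamN' = sSup {c : ℝ | ∃ x : Fin n → ℝ, x ≠ 0 ∧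
      c = (x ⬝ᵥ ((L + E) *ᵥ x)) / (x ⬝ᵥ x)})
    (τ : ℝ) (hτ : τ = max |lamN - lam2'| lamN') :
    Real.sqrt (((L + E - r • 1) *ᵥ xhat) ⬝ᵥ ((L + E - r • 1) *ᵥ xhat)) ≤
      τ + ‖Matrix.toEuclideanCLM (𝕜 := ℝ) E‖ := by
  have hLsym : Lᵀ = L := by
    rw [hL]; simp [Matrix.mul_assoc]
  have hLpsd : ∀ x, 0 ≤ x ⬝ᵥ (L *ᵥ x) := by
    intro x
    have : x ⬝ᵥ (L *ᵥ x) = (B *ᵥ x) ⬝ᵥ (diagonal w *ᵥ (B *ᵥ x)) := by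
      rw [hL, Matrix.mul_assoc, ← mulVec_mulVec, ← mulVec_mulVec, dotProduct_mulVec,
        vecMul_transpose]
    rw [this]
    refine Finset.sum_nonneg fun e _ => ?_
    rw [mulVec_diagonal]
    have := mul_nonneg (hw e) (mul_self_nonneg ((B *ᵥ x) e))
    linarith
  have hone : (fun _ => (1 : ℝ)) ⬝ᵥ (E *ᵥ φ) = 0 := by
    rw [hE]
    simp only [Matrix.mul_assoc]
    rw [← mulVec_mulVec, dotProduct_mulVec, vecMul_transpose, hB, zero_dotProduct]
  have hyone : (fun _ => (1 : ℝ)) ⬝ᵥ y = 0 := by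
    rw [hy, dotProduct_smul, dotProduct_sub, dotProduct_smul, hone, hφone]; simp
  have hr1 : r ≤ lamN' := by
    rw [hlamN']
    refine le_csSup ⟨‖Matrix.toEuclideanCLM (𝕜 := ℝ) (L + E)‖, ?_⟩ ⟨y, hy0, hr⟩
    rintro c ⟨x, hx, rfl⟩
    exact (abs_le.1 (aux_ray _ hx)).2
  have hr2 : lam2' ≤ r := by
    rw [hlam2']
    refine csInf_le ⟨-‖Matrix.toEuclideanCLM (𝕜 := ℝ) (L + E)‖, ?_⟩ ⟨y, hy0, hyone, hr⟩
    rintro c ⟨x, hx, _, rfl⟩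
    exact (abs_le.1 (aux_ray _ hx)).1
  have hLN : ∀ x, x ⬝ᵥ (L *ᵥ x) ≤ lamN * (x ⬝ᵥ x) := by
    intro x
    by_cases hx : x = 0
    · simp [hx]
    rw [← div_le_iff₀ (aux_pos hx), hlamN]
    refine le_csSup ⟨‖Matrix.toEuclideanCLM (𝕜 := ℝ) L‖, ?_⟩ ⟨x, hx, rfl⟩
    rintro c ⟨x, hx, rfl⟩
    exact (abs_le.1 (aux_ray _ hx)).2
  have ht1 : lamN - r ≤ τ := by
    have := le_max_left |lamN - lam2'| lamN'
    have := le_abs_self (lamN - lam2')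
    linarith
  have ht2 : r ≤ τ := by
    have := le_max_right |lamN - lam2'| lamN'
    linarith
  have ht0 : 0 ≤ τ := by
    rw [hτ]; exact le_trans (abs_nonneg _) (le_max_left _ _)
  have hquad : ∀ x : Fin n → ℝ, x ⬝ᵥ ((L - r • (1 : Matrix (Fin n) (Fin n) ℝ)) *ᵥ x)
      = x ⬝ᵥ (L *ᵥ x) - r * (x ⬝ᵥ x) := by
    intro x
    simp [sub_mulVec, smul_mulVec, dotProduct_sub]
  have hnn : ∀ x : Fin n → ℝ, 0 ≤ x ⬝ᵥ x := fun x =>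
    Finset.sum_nonneg fun i _ => mul_self_nonneg _
  have hS := aux_sym (L - r • (1 : Matrix (Fin n) (Fin n) ℝ)) (by simp [hLsym]) τ ht0
    (by
      intro x
      rw [hquad]
      have := mul_le_mul_of_nonneg_right ht1 (hnn x)
      have := hLN x
      linarith)
    (by
      intro x
      rw [hquad]
      have := mul_le_mul_of_nonneg_right ht2 (hnn x)
      have := hLpsd x
      linarith) xhat
  have hx1 : xhat ⬝ᵥ xhat = 1 := by
    have hp := aux_pos hy0
    rw [hxhat, smul_dotProduct, dotProduct_smul, smul_eq_mul, smul_eq_mul, ← mul_assoc,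
      ← mul_inv, Real.mul_self_sqrt hp.le, inv_mul_cancel₀ hp.ne']
  have hxn : ‖WithLp.toLp 2 xhat‖ = 1 := by rw [← aux_norm_sq, hx1, Real.sqrt_one]
  have hEx := aux_op E xhat
  rw [hxn, mul_one] at hEx
  have hSx : ‖WithLp.toLp 2 ((L - r • (1 : Matrix (Fin n) (Fin n) ℝ)) *ᵥ xhat)‖ ≤ τ := by
    rw [hx1, mul_one, aux_dot_sq] at hS
    exact abs_le_of_sq_le_sq' hS ht0 |>.2
  have hsplit : (L + E - r • (1 : Matrix (Fin n) (Fin n) ℝ)) *ᵥ xhat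
      = (L - r • (1 : Matrix (Fin n) (Fin n) ℝ)) *ᵥ xhat + E *ᵥ xhat := by
    rw [← add_mulVec]; congr 1; abel
  rw [aux_norm_sq, hsplit, WithLp.toLp_add]
  exact (norm_add_le _ _).trans (add_le_add hSx hEx)
end

section
/- The Rayleigh-quotient estimate r(yᵢ) is a (τ + ‖E‖₂)-pseudo-eigenvalue of the Laplacian L; that is, the smallest singular value of the matrix r(yᵢ)·I − L satisfies σ_min(r(yᵢ)·I − L) ≤ τ + ‖E‖₂. -/
open Matrix

lemma rq_abs_le {n : ℕ} (M : Matrix (Fin n) (Fin n) ℝ) (x : Fin n → ℝ) (hx : x ≠ 0) :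
    |(x ⬝ᵥ (M *ᵥ x)) / (x ⬝ᵥ x)| ≤ ∑ i, ∑ j, |M i j| := by
  have hpos : 0 < x ⬝ᵥ x := by
    have h0 : 0 ≤ x ⬝ᵥ x := Finset.sum_nonneg (fun i _ => mul_self_nonneg (x i))
    refine lt_of_le_of_ne h0 (fun h => hx ?_)
    exact dotProduct_self_eq_zero.mp h.symm
  have hle : ∀ i, x i * x i ≤ x ⬝ᵥ x := fun i =>
    Finset.single_le_sum (f := fun i => x i * x i)
      (fun i _ => mul_self_nonneg (x i)) (Finset.mem_univ i)
  rw [abs_div, abs_of_pos hpos, div_le_iff₀ hpos]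
  have : x ⬝ᵥ (M *ᵥ x) = ∑ i, ∑ j, x i * (M i j * x j) := by
    simp only [dotProduct, mulVec, Finset.mul_sum]
  rw [this, Finset.sum_mul]
  refine (Finset.abs_sum_le_sum_abs _ _).trans (Finset.sum_le_sum fun i _ => ?_)
  rw [Finset.sum_mul]
  refine (Finset.abs_sum_le_sum_abs _ _).trans (Finset.sum_le_sum fun j _ => ?_)
  have h1 : |x i| * |x j| ≤ x ⬝ᵥ x := by
    have := hle i
    have := hle j
    nlinarith [sq_nonneg (|x i| - |x j|), abs_mul_abs_self (x i), abs_mul_abs_self (x j)]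
  calc |x i * (M i j * x j)| = |M i j| * (|x i| * |x j|) := by
        rw [abs_mul, abs_mul]; ring
    _ ≤ _ := mul_le_mul_of_nonneg_left h1 (abs_nonneg _)

/-- The Rayleigh-quotient estimate `r(yᵢ)` is a `(τ + ‖E‖₂)`-pseudo-eigenvalue of the
Laplacian `L`: the smallest singular value of `r(yᵢ) I − L`, namely
`σ_min = √(λ_min((r(yᵢ)I − L)ᵀ (r(yᵢ)I − L)))`, satisfies
`σ_min(r(yᵢ) I − L) ≤ τ + ‖E‖₂`. Here `L = Bᵀ W B` is the Laplacian of an undirected weighted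
graph (`B 𝟙 = 0`), `E = Bᵀ W^{1/2} D W^{1/2} B` a perturbation, `φ` a unit eigenvector of `L`
for `λᵢ` with `𝟙ᵀφ = 0`, `a = Eφ`, `ε = φᵀEφ ≠ 0`, `aᵀ(L+E−λᵢI−εI)a ≠ 0`,
`yᵢ = (1/ε)((aᵀa/aᵀ(L+E−λᵢI−εI)a)·Eφ − φ) ≠ 0`, `r(y) = yᵀ(L+E)y/yᵀy`,
`λ₂(L+E)`/`λₙ(L+E)` the restricted infimum and supremum of the Rayleigh quotient of `L+E`,
`λₙ` the largest eigenvalue of `L`, and `τ = max(|λₙ − λ₂(L+E)|, λₙ(L+E))`. -/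
theorem rayleigh_estimate_pseudo_eigenvalue {n m : ℕ} (hn : 0 < n)
    (B : Matrix (Fin m) (Fin n) ℝ) (hB : B *ᵥ (fun _ => (1 : ℝ)) = 0)
    (w : Fin m → ℝ) (hw : ∀ e, 0 ≤ w e)
    (L : Matrix (Fin n) (Fin n) ℝ) (hL : L = Bᵀ * diagonal w * B)
    (d : Fin m → ℝ)
    (E : Matrix (Fin n) (Fin n) ℝ)
    (hE : E = Bᵀ * diagonal (fun e => Real.sqrt (w e)) * diagonal d *
      diagonal (fun e => Real.sqrt (w e)) * B)
    (φ : Fin n → ℝ) (lam_i : ℝ)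
    (hφ : L *ᵥ φ = lam_i • φ)
    (hφnorm : φ ⬝ᵥ φ = 1)
    (hφone : (fun _ => (1 : ℝ)) ⬝ᵥ φ = 0)
    (a : Fin n → ℝ) (ha : a = E *ᵥ φ)
    (ε : ℝ) (hεdef : ε = φ ⬝ᵥ (E *ᵥ φ)) (hε0 : ε ≠ 0)
    (den : ℝ)
    (hden : den = a ⬝ᵥ ((L + E - lam_i • (1 : Matrix (Fin n) (Fin n) ℝ) - ε • 1) *ᵥ a))
    (hden0 : den ≠ 0)
    (y : Fin n → ℝ)
    (hy : y = ε⁻¹ • (((a ⬝ᵥ a) / den) • (E *ᵥ φ) - φ))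
    (hy0 : y ≠ 0)
    (r : ℝ) (hr : r = (y ⬝ᵥ ((L + E) *ᵥ y)) / (y ⬝ᵥ y))
    (lamN : ℝ)
    (hlamN : lamN = sSup {c : ℝ | ∃ x : Fin n → ℝ, x ≠ 0 ∧
      c = (x ⬝ᵥ (L *ᵥ x)) / (x ⬝ᵥ x)})
    (lam2' : ℝ)
    (hlam2' : lam2' = sInf {c : ℝ | ∃ x : Fin n → ℝ, x ≠ 0 ∧
      (fun _ => (1 : ℝ)) ⬝ᵥ x = 0 ∧ c = (x ⬝ᵥ ((L + E) *ᵥ x)) / (x ⬝ᵥ x)})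
    (lamN' : ℝ)
    (hlamN' : lamN' = sSup {c : ℝ | ∃ x : Fin n → ℝ, x ≠ 0 ∧
      c = (x ⬝ᵥ ((L + E) *ᵥ x)) / (x ⬝ᵥ x)})
    (τ : ℝ) (hτ : τ = max |lamN - lam2'| lamN') :
    Real.sqrt (sInf (spectrum ℝ ((r • (1 : Matrix (Fin n) (Fin n) ℝ) - L)ᵀ *
        (r • (1 : Matrix (Fin n) (Fin n) ℝ) - L)))) ≤
      τ + ‖Matrix.toEuclideanCLM (𝕜 := ℝ) E‖ := by
  have hL1 : L *ᵥ (fun _ => (1 : ℝ)) = 0 := by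
    rw [hL, ← mulVec_mulVec, hB, mulVec_zero]
  have hE1 : E *ᵥ (fun _ => (1 : ℝ)) = 0 := by
    rw [hE, ← mulVec_mulVec, hB, mulVec_zero]
  have hEt : Eᵀ = E := by
    rw [hE]
    simp only [transpose_mul, diagonal_transpose, transpose_transpose, Matrix.mul_assoc]
  have hLt : Lᵀ = L := by
    rw [hL]
    simp only [transpose_mul, diagonal_transpose, transpose_transpose, Matrix.mul_assoc]
  have hEφ : (fun _ => (1 : ℝ)) ⬝ᵥ (E *ᵥ φ) = 0 := by
    rw [dotProduct_mulVec, ← mulVec_transpose, hEt, hE1, zero_dotProduct]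
  have hy1 : (fun _ => (1 : ℝ)) ⬝ᵥ y = 0 := by
    rw [hy, dotProduct_smul, dotProduct_sub, dotProduct_smul, hEφ, hφone]
    simp
  have hrN : r ≤ lamN' := by
    rw [hlamN']
    refine le_csSup ⟨∑ i, ∑ j, |(L + E) i j|, ?_⟩ ⟨y, hy0, hr⟩
    rintro c ⟨x, hx, rfl⟩
    exact (le_abs_self _).trans (rq_abs_le _ x hx)
  have hr2 : lam2' ≤ r := by
    rw [hlam2']
    refine csInf_le ⟨-∑ i, ∑ j, |(L + E) i j|, ?_⟩ ⟨y, hy0, hy1, hr⟩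
    rintro c ⟨x, hx, -, rfl⟩
    exact (abs_le.mp (rq_abs_le _ x hx)).1
  have hN0 : 0 ≤ lamN := by
    rw [hlamN]
    refine Real.sSup_nonneg ?_
    rintro c ⟨x, hx, rfl⟩
    refine div_nonneg ?_ (Finset.sum_nonneg (fun i _ => mul_self_nonneg (x i)))
    have : x ⬝ᵥ (L *ᵥ x) = (B *ᵥ x) ⬝ᵥ (diagonal w *ᵥ (B *ᵥ x)) := by
      rw [hL, ← mulVec_mulVec, ← mulVec_mulVec, dotProduct_mulVec, vecMul_transpose]
    rw [this]
    refine Finset.sum_nonneg fun e _ => ?_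
    rw [mulVec_diagonal]
    nlinarith [mul_nonneg (hw e) (mul_self_nonneg ((B *ᵥ x) e))]
  have hrτ : |r| ≤ τ := by
    rw [hτ]
    rcases le_total 0 r with h | h
    · rw [abs_of_nonneg h]
      exact hrN.trans (le_max_right _ _)
    · rw [abs_of_nonpos h]
      refine le_trans ?_ (le_max_left _ _)
      exact le_trans (by linarith) (le_abs_self _)
  have hspec : r ^ 2 ∈ spectrum ℝ ((r • (1 : Matrix (Fin n) (Fin n) ℝ) - L)ᵀ *
        (r • (1 : Matrix (Fin n) (Fin n) ℝ) - L)) := by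
    rw [← Matrix.spectrum_toLin', ← Module.End.hasEigenvalue_iff_mem_spectrum]
    refine Module.End.hasEigenvalue_of_hasEigenvector (x := fun _ => (1 : ℝ)) ⟨?_, ?_⟩
    · rw [Module.End.mem_eigenspace_iff, Matrix.toLin'_apply, ← mulVec_mulVec, transpose_sub,
        transpose_smul, transpose_one, hLt]
      simp only [sub_mulVec, smul_mulVec, one_mulVec, hL1, sub_zero, mulVec_smul, smul_zero]
      rw [smul_smul, sq]
    · intro h
      have := congrFun h ⟨0, hn⟩
      simp at this
  have hfin : (spectrum ℝ ((r • (1 : Matrix (Fin n) (Fin n) ℝ) - L)ᵀ *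
        (r • (1 : Matrix (Fin n) (Fin n) ℝ) - L))).Finite := Matrix.finite_spectrum _
  have h1 := Real.sqrt_le_sqrt (csInf_le hfin.bddBelow hspec)
  rw [Real.sqrt_sq_eq_abs] at h1
  exact (h1.trans hrτ).trans (le_add_of_nonneg_right (norm_nonneg _))
end

section
/- Let L be an n×n real symmetric positive semidefinite matrix (n ≥ 1) with L𝟙 = 0 for the all-ones vector 𝟙, and suppose some eigenvalue of L is strictly greater than 2. Then for every p ∈ ℝ the matrix M = L − p·I is not orthogonal, i.e. MᵀM ≠ I. -/
open Matrix

/-- Let `L` be an `n × n` real symmetric positive semidefinite matrix (`n ≥ 1`) with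
`L 𝟙 = 0` for the all-ones vector `𝟙`, and suppose some eigenvalue of `L` is strictly greater
than `2`. Then for every `p ∈ ℝ` the matrix `M = L − p I` is not orthogonal, i.e. `MᵀM ≠ I`. -/
theorem laplacian_shift_not_orthogonal {n : ℕ} (hn : 0 < n)
    (L : Matrix (Fin n) (Fin n) ℝ) (hL : L.PosSemidef)
    (hone : L *ᵥ (fun _ => (1 : ℝ)) = 0)
    (hbig : ∃ μ ∈ spectrum ℝ L, 2 < μ) :
    ∀ p : ℝ, (L - p • 1)ᵀ * (L - p • 1) ≠ 1 := by
  intro p h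
  have hT : Lᵀ = L := by
    have := hL.1
    rwa [Matrix.IsHermitian, Matrix.conjTranspose_eq_transpose_of_trivial] at this
  have key : ∀ (μ : ℝ) (v : Fin n → ℝ), L *ᵥ v = μ • v → v ≠ 0 → (μ - p) ^ 2 = 1 := by
    intro μ v hv hv0
    have h1 : (L - p • (1 : Matrix (Fin n) (Fin n) ℝ)) *ᵥ v = (μ - p) • v := by
      rw [Matrix.sub_mulVec, hv, Matrix.smul_mulVec, Matrix.one_mulVec, sub_smul]
    have h2 := congrArg (fun A => A *ᵥ v) h
    simp only [Matrix.transpose_sub, Matrix.transpose_smul, Matrix.transpose_one, hT] at h2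
    rw [← Matrix.mulVec_mulVec, h1, Matrix.mulVec_smul, h1, Matrix.one_mulVec, smul_smul] at h2
    obtain ⟨i, hi⟩ := Function.ne_iff.mp hv0
    have h3 := congrFun h2 i
    simp only [Pi.smul_apply, smul_eq_mul, Pi.zero_apply] at h3 hi
    have h4 : (μ - p) * (μ - p) = 1 := mul_right_cancel₀ hi (by rw [h3, one_mul])
    rw [sq, h4]
  obtain ⟨μ, hμ, h2μ⟩ := hbig
  have hp := key 0 (fun _ => 1) (by rw [hone, zero_smul])
    (fun h0 => one_ne_zero (congrFun h0 ⟨0, hn⟩))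
  rw [← Matrix.spectrum_toLin', ← Module.End.hasEigenvalue_iff_mem_spectrum] at hμ
  obtain ⟨v, hv⟩ := hμ.exists_hasEigenvector
  have hq := key μ v (by simpa using hv.apply_eq_smul) hv.2
  have h5 : μ = 2 * p := by
    have : μ * (μ - 2 * p) = 0 := by linarith
    rcases mul_eq_zero.mp this with h | h <;> linarith
  nlinarith
end

section
/- Let Φ be an n×n real orthogonal matrix whose first column is (1/√n)·𝟙, let Λ = diag(λ₁,…,λₙ) with λ₁ = 0, and set L = ΦΛΦᵀ. Let B ∈ ℝ^{m×n} satisfy B𝟙 = 0, let W and D be m×m diagonal matrices with W having nonnegative entries, set E = Bᵀ W^{1/2} D W^{1/2} B, and let u₁,…,uₙ denote the columns of U = W^{1/2} B Φ. Then for every λ ∈ ℝ, det(L + E − λI) = (−λ) · det( [ uᵢᵀ D uⱼ + (λᵢ − λ)δᵢⱼ ]_{i,j = 2,…,n} ), where δᵢⱼ is the Kronecker delta. -/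
open Matrix

/-- Let `Φ` be an `n × n` real orthogonal matrix whose first column is `𝟙/√n`, let
`Λ = diag(λ₁, …, λₙ)` with `λ₁ = 0`, and `L = Φ Λ Φᵀ`. Let `B ∈ ℝ^{m×n}` satisfy `B 𝟙 = 0`,
let `W`, `D` be diagonal with `W` nonnegative, `E = Bᵀ W^{1/2} D W^{1/2} B`, and let
`u₁, …, uₙ` be the columns of `U = W^{1/2} B Φ`. Then for every `λ ∈ ℝ`,
`det(L + E − λI) = (−λ) · det([uᵢᵀ D uⱼ + (λᵢ − λ)δᵢⱼ]_{i,j ≥ 2})`. -/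
theorem charpoly_reduction_perturbed_laplacian {n m : ℕ} (hn : 0 < n)
    (Φ : Matrix (Fin n) (Fin n) ℝ) (hΦ : Φᵀ * Φ = 1)
    (hΦ0 : ∀ i : Fin n, Φ i ⟨0, hn⟩ = 1 / Real.sqrt n)
    (lam : Fin n → ℝ) (hlam0 : lam ⟨0, hn⟩ = 0)
    (L : Matrix (Fin n) (Fin n) ℝ) (hLdef : L = Φ * diagonal lam * Φᵀ)
    (B : Matrix (Fin m) (Fin n) ℝ) (hB : B *ᵥ (fun _ => (1 : ℝ)) = 0)
    (w d : Fin m → ℝ) (hw : ∀ e, 0 ≤ w e)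
    (E : Matrix (Fin n) (Fin n) ℝ)
    (hE : E = Bᵀ * diagonal (fun e => Real.sqrt (w e)) * diagonal d *
      diagonal (fun e => Real.sqrt (w e)) * B)
    (U : Matrix (Fin m) (Fin n) ℝ)
    (hU : U = diagonal (fun e => Real.sqrt (w e)) * B * Φ) :
    ∀ lmb : ℝ,
      (L + E - lmb • 1).det =
        (-lmb) * Matrix.det (Matrix.of fun (i j : {k : Fin n // k ≠ ⟨0, hn⟩}) =>
          (fun e => U e i.1) ⬝ᵥ (diagonal d *ᵥ (fun e => U e j.1)) +
            (if i = j then lam i.1 - lmb else 0)) := by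
  intro lmb
  have hΦ' : Φ * Φᵀ = 1 := mul_eq_one_comm.mp hΦ
  have hM : Φᵀ * (L + E - lmb • 1) * Φ = diagonal lam + Uᵀ * (diagonal d * U) - lmb • 1 := by
    have h1 : Φᵀ * L * Φ = diagonal lam := by
      rw [hLdef]
      calc Φᵀ * (Φ * diagonal lam * Φᵀ) * Φ = (Φᵀ * Φ) * diagonal lam * (Φᵀ * Φ) := by
            simp only [Matrix.mul_assoc]
        _ = _ := by rw [hΦ]; simp
    have h2 : Φᵀ * E * Φ = Uᵀ * (diagonal d * U) := by
      rw [hE, hU]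
      simp only [Matrix.transpose_mul, diagonal_transpose, Matrix.mul_assoc]
    rw [Matrix.mul_sub, Matrix.sub_mul, Matrix.mul_add, Matrix.add_mul, h1, h2]
    simp [hΦ]
  have hdet : (L + E - lmb • 1).det = (Φᵀ * (L + E - lmb • 1) * Φ).det := by
    have h3 : Φᵀ.det * Φ.det = 1 := by rw [← det_mul, hΦ, det_one]
    rw [det_mul, det_mul, mul_right_comm, h3, one_mul]
  have hU0 : ∀ e, U e ⟨0, hn⟩ = 0 := by
    intro e
    have hb : ∑ j, B e j = 0 := by
      have := congrFun hB e
      simpa [mulVec, dotProduct] using this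
    rw [hU, Matrix.mul_assoc, diagonal_mul, Matrix.mul_apply]
    simp only [hΦ0]
    rw [← Finset.sum_mul, hb]
    simp
  have hent : ∀ i j, (Uᵀ * (diagonal d * U)) i j =
      (fun e => U e i) ⬝ᵥ (diagonal d *ᵥ (fun e => U e j)) := by
    intro i j
    rw [Matrix.mul_apply]
    simp only [diagonal_mul, dotProduct, mulVec_diagonal, transpose_apply]
  rw [hdet, hM, twoBlockTriangular_det _ (fun i => i = ⟨0, hn⟩)]
  · congr 1
    · have : Subsingleton {a : Fin n // a = ⟨0, hn⟩} :=
        ⟨fun a b => Subtype.ext (a.2.trans b.2.symm)⟩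
      refine (@det_eq_elem_of_subsingleton {a : Fin n // a = ⟨0, hn⟩} _ (_) _ _ this _
        ⟨⟨0, hn⟩, rfl⟩).trans ?_
      change (diagonal lam + Uᵀ * (diagonal d * U) - lmb • 1 : Matrix (Fin n) (Fin n) ℝ) ⟨0, hn⟩ ⟨0, hn⟩ = -lmb
      rw [Matrix.sub_apply, Matrix.add_apply, hent]
      simp [hU0, hlam0, dotProduct]
    · congr 1
      ext i j
      change (diagonal lam + Uᵀ * (diagonal d * U) - lmb • 1 : Matrix (Fin n) (Fin n) ℝ) i.1 j.1 = _
      rw [Matrix.sub_apply, Matrix.add_apply, hent]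
      simp only [of_apply, Matrix.smul_apply, Matrix.one_apply, diagonal_apply, Subtype.ext_iff]
      split_ifs <;> simp only [smul_eq_mul] <;> ring
  · rintro i hi j rfl
    rw [Matrix.sub_apply, Matrix.add_apply, hent, diagonal_apply_ne _ hi, Matrix.smul_apply,
      Matrix.one_apply_ne hi]
    simp [hU0, dotProduct, mulVec]
end
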